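/- Let N ≥ 1 and let α assign to each stage 0 ≤ k ≤ N−1 a set of state rows and a set of input rows. Define P_N(α) as the set of x0 ∈ F_N whose horizon-N active pattern equals α at every stage 0,…,N−1 and has no active terminal rows, and, for l ≥ 0, define P_{N+l}(α0^l) as the set of x0 ∈ F_{N+l} whose horizon-(N+l) active pattern equals α at the stages 0,…,N−1, has no active state or input rows at the stages N,…,N+l−1, and has no active terminal rows. Then for every l ≥ 0 one has the set equality P_N(α) = P_{N+l}(α0^l), and for every x0 in this set the optimal solutions coincide: u*_{N+l}(x0,k) = u*_N(x0,k) for 0 ≤ k ≤ N−1, and u*_{N+l}(x0,k) = K∞ x*_{N+l}(x0,k) for N ≤ k ≤ N+l−1. In particular the polytope defined by an active set whose terminal part is empty, and the optimal solution on it, are persistent from horizon N on. -/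

import Mathlib

open Matrix Set

noncomputable section

/-- State trajectory generated by dynamics `x(k+1) = A x(k) + B u(k)` from `x0`. -/
def traj {n m : ℕ} (A : Matrix (Fin n) (Fin n) ℝ) (B : Matrix (Fin n) (Fin m) ℝ)
    (x0 : Fin n → ℝ) (u : ℕ → Fin m → ℝ) : ℕ → Fin n → ℝ
  | 0 => x0
  | k + 1 => A *ᵥ traj A B x0 u k + B *ᵥ u k

/-- Feasibility of a control sequence for horizon `N` and initial state `x0`. -/
def Feasible {n m qX qU qT : ℕ} (A : Matrix (Fin n) (Fin n) ℝ) (B : Matrix (Fin n) (Fin m) ℝ)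
    (Cx : Matrix (Fin qX) (Fin n) ℝ) (cx : Fin qX → ℝ)
    (Cu : Matrix (Fin qU) (Fin m) ℝ) (cu : Fin qU → ℝ)
    (Ct : Matrix (Fin qT) (Fin n) ℝ) (ct : Fin qT → ℝ)
    (N : ℕ) (x0 : Fin n → ℝ) (u : ℕ → Fin m → ℝ) : Prop :=
  (∀ k < N, Cx *ᵥ traj A B x0 u k ≤ cx ∧ Cu *ᵥ u k ≤ cu) ∧
    Ct *ᵥ traj A B x0 u N ≤ ct

/-- The quadratic cost `J_N(x0, u)`. -/
def cost {n m : ℕ} (A : Matrix (Fin n) (Fin n) ℝ) (B : Matrix (Fin n) (Fin m) ℝ)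
    (Q : Matrix (Fin n) (Fin n) ℝ) (R : Matrix (Fin m) (Fin m) ℝ)
    (P : Matrix (Fin n) (Fin n) ℝ)
    (N : ℕ) (x0 : Fin n → ℝ) (u : ℕ → Fin m → ℝ) : ℝ :=
  (1 / 2) * (traj A B x0 u N ⬝ᵥ (P *ᵥ traj A B x0 u N)) +
    (1 / 2) * ∑ k ∈ Finset.range N,
      (traj A B x0 u k ⬝ᵥ (Q *ᵥ traj A B x0 u k) + u k ⬝ᵥ (R *ᵥ u k))

/-- `u` is an optimal (feasible, cost-minimizing) sequence for horizon `N` at `x0`. -/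
def IsOptimal {n m qX qU qT : ℕ} (A : Matrix (Fin n) (Fin n) ℝ) (B : Matrix (Fin n) (Fin m) ℝ)
    (Q : Matrix (Fin n) (Fin n) ℝ) (R : Matrix (Fin m) (Fin m) ℝ)
    (P : Matrix (Fin n) (Fin n) ℝ)
    (Cx : Matrix (Fin qX) (Fin n) ℝ) (cx : Fin qX → ℝ)
    (Cu : Matrix (Fin qU) (Fin m) ℝ) (cu : Fin qU → ℝ)
    (Ct : Matrix (Fin qT) (Fin n) ℝ) (ct : Fin qT → ℝ)
    (N : ℕ) (x0 : Fin n → ℝ) (u : ℕ → Fin m → ℝ) : Prop :=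
  Feasible A B Cx cx Cu cu Ct ct N x0 u ∧
    ∀ v, Feasible A B Cx cx Cu cu Ct ct N x0 v →
      cost A B Q R P N x0 u ≤ cost A B Q R P N x0 v

/-- The feasible set `F_N` of initial states. -/
def FeasSet {n m qX qU qT : ℕ} (A : Matrix (Fin n) (Fin n) ℝ) (B : Matrix (Fin n) (Fin m) ℝ)
    (Cx : Matrix (Fin qX) (Fin n) ℝ) (cx : Fin qX → ℝ)
    (Cu : Matrix (Fin qU) (Fin m) ℝ) (cu : Fin qU → ℝ)
    (Ct : Matrix (Fin qT) (Fin n) ℝ) (ct : Fin qT → ℝ)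
    (N : ℕ) : Set (Fin n → ℝ) :=
  {x0 | ∃ u, Feasible A B Cx cx Cu cu Ct ct N x0 u}

/-- The set `P_{N+l}(α 0^l)` of initial states whose horizon-`(N+l)` active pattern equals `α`
at the stages `0, …, N-1`, has no active state or input rows at the stages `N, …, N+l-1`,
and has no active terminal rows. -/
def PolyPad {n m qX qU qT : ℕ} (A : Matrix (Fin n) (Fin n) ℝ) (B : Matrix (Fin n) (Fin m) ℝ)
    (Q : Matrix (Fin n) (Fin n) ℝ) (R : Matrix (Fin m) (Fin m) ℝ)
    (P : Matrix (Fin n) (Fin n) ℝ)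
    (Cx : Matrix (Fin qX) (Fin n) ℝ) (cx : Fin qX → ℝ)
    (Cu : Matrix (Fin qU) (Fin m) ℝ) (cu : Fin qU → ℝ)
    (Ct : Matrix (Fin qT) (Fin n) ℝ) (ct : Fin qT → ℝ)
    (N l : ℕ) (α : ℕ → Set (Fin qX) × Set (Fin qU)) : Set (Fin n → ℝ) :=
  {x0 | ∃ u, IsOptimal A B Q R P Cx cx Cu cu Ct ct (N + l) x0 u ∧
    (∀ k < N, (∀ i, (Cx *ᵥ traj A B x0 u k) i = cx i ↔ i ∈ (α k).1) ∧
              (∀ j, (Cu *ᵥ u k) j = cu j ↔ j ∈ (α k).2)) ∧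
    (∀ k, N ≤ k → k < N + l →
      (∀ i, (Cx *ᵥ traj A B x0 u k) i < cx i) ∧ (∀ j, (Cu *ᵥ u k) j < cu j)) ∧
    (∀ r, (Ct *ᵥ traj A B x0 u (N + l)) r < ct r)}

section LinearInequalities

variable {q n : ℕ} {M : Matrix (Fin q) (Fin n) ℝ} {c : Fin q → ℝ}

lemma eventually_mulVec_add_smul_le {a : Fin n → ℝ} (d : Fin n → ℝ)
    (h : ∀ i, (M *ᵥ a) i < c i) :
    ∀ᶠ t in nhdsWithin (0 : ℝ) (Ioi 0), M *ᵥ (a + t • d) ≤ c := by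
  simp only [Pi.le_def]
  refine Filter.eventually_all.2 fun i => ?_
  have hc : Continuous fun t : ℝ => (M *ᵥ a) i + t * (M *ᵥ d) i := by fun_prop
  have h0 : ∀ᶠ t in nhdsWithin (0 : ℝ) (Ioi 0), (M *ᵥ a) i + t * (M *ᵥ d) i < c i :=
    nhdsWithin_le_nhds (hc.continuousAt.eventually_lt continuousAt_const (by simpa using h i))
  filter_upwards [h0] with t ht
  simpa [mulVec_add, mulVec_smul] using ht.le

lemma mulVec_lt_of_mulVec_add_smul_self_le {a : Fin n → ℝ} {t : ℝ} (hc : ∀ i, 0 < c i)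
    (ht : 0 < t) (h : M *ᵥ (a + t • a) ≤ c) (i : Fin q) : (M *ᵥ a) i < c i := by
  have hi := h i
  simp only [mulVec_add, mulVec_smul, Pi.add_apply, Pi.smul_apply, smul_eq_mul] at hi
  by_contra! hlt
  nlinarith [hc i]

lemma mulVec_segment_le {a b : Fin n → ℝ} {t : ℝ} (ht0 : 0 ≤ t) (ht1 : t ≤ 1)
    (ha : M *ᵥ a ≤ c) (hb : M *ᵥ b ≤ c) : M *ᵥ (a + t • (b - a)) ≤ c := by
  intro i
  have hai := ha i
  have hbi := hb i
  simp only [mulVec_add, mulVec_smul, mulVec_sub, Pi.add_apply, Pi.smul_apply, Pi.sub_apply,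
    smul_eq_mul]
  nlinarith [mul_le_mul_of_nonneg_left hbi ht0,
    mul_le_mul_of_nonneg_left hai (sub_nonneg.2 ht1)]

end LinearInequalities

lemma quadForm_segment {m : ℕ} (S : Matrix (Fin m) (Fin m) ℝ) (a b : Fin m → ℝ) (t : ℝ) :
    (a + t • (b - a)) ⬝ᵥ (S *ᵥ (a + t • (b - a))) =
      (1 - t) * (a ⬝ᵥ (S *ᵥ a)) + t * (b ⬝ᵥ (S *ᵥ b)) -
        t * (1 - t) * ((b - a) ⬝ᵥ (S *ᵥ (b - a))) := by
  simp only [mulVec_add, mulVec_smul, mulVec_sub, dotProduct_add, add_dotProduct, dotProduct_sub,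
    sub_dotProduct, dotProduct_smul, smul_dotProduct, smul_eq_mul]
  ring

section Trajectories

variable {n m : ℕ} {A : Matrix (Fin n) (Fin n) ℝ} {B : Matrix (Fin n) (Fin m) ℝ}
  {x0 : Fin n → ℝ} {u v : ℕ → Fin m → ℝ}

lemma traj_congr {N : ℕ} (h : ∀ k < N, u k = v k) {k : ℕ} (hk : k ≤ N) :
    traj A B x0 u k = traj A B x0 v k := by
  induction k with
  | zero => rfl
  | succ k ih => simp only [traj, ih (by omega), h k (by omega)]

lemma traj_segment (t : ℝ) (k : ℕ) :
    traj A B x0 (u + t • (v - u)) k =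
      traj A B x0 u k + t • (traj A B x0 v k - traj A B x0 u k) := by
  induction k with
  | zero => simp [traj]
  | succ k ih =>
    simp only [traj, ih, Pi.add_apply, Pi.smul_apply, Pi.sub_apply, mulVec_add, mulVec_smul,
      mulVec_sub]
    module

lemma traj_add_of_feedback {K : Matrix (Fin m) (Fin n) ℝ} {N l : ℕ}
    (h : ∀ k, N ≤ k → k < N + l → u k = K *ᵥ traj A B x0 u k) {j : ℕ} (hj : j ≤ l) :
    traj A B x0 u (N + j) = (A + B * K) ^ j *ᵥ traj A B x0 u N := by
  induction j with
  | zero => simp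
  | succ j ih =>
    have ih := ih (by omega)
    rw [← add_assoc, traj, h (N + j) (by omega) (by omega), ih, pow_succ', ← mulVec_mulVec,
      add_mulVec, ← mulVec_mulVec]

end Trajectories

/-- The deviation of a control sequence from the linear feedback `u = K x`. -/
def feedbackResidual {n m : ℕ} (A : Matrix (Fin n) (Fin n) ℝ) (B : Matrix (Fin n) (Fin m) ℝ)
    (K : Matrix (Fin m) (Fin n) ℝ) (x0 : Fin n → ℝ) (u : ℕ → Fin m → ℝ) (k : ℕ) : Fin m → ℝ :=
  u k - K *ᵥ traj A B x0 u k

/-- Follow `u` up to stage `N`, and the linear feedback `K` afterwards. -/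
def feedbackExtend {n m : ℕ} (A : Matrix (Fin n) (Fin n) ℝ) (B : Matrix (Fin n) (Fin m) ℝ)
    (K : Matrix (Fin m) (Fin n) ℝ) (N : ℕ) (x0 : Fin n → ℝ) (u : ℕ → Fin m → ℝ) :
    ℕ → Fin m → ℝ :=
  fun k => if k < N then u k else K *ᵥ ((A + B * K) ^ (k - N) *ᵥ traj A B x0 u N)

section Feedback

variable {n m : ℕ} {A : Matrix (Fin n) (Fin n) ℝ} {B : Matrix (Fin n) (Fin m) ℝ}
  {K : Matrix (Fin m) (Fin n) ℝ} {x0 : Fin n → ℝ} {u v : ℕ → Fin m → ℝ} {N : ℕ}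

lemma feedbackExtend_of_lt {k : ℕ} (hk : k < N) : feedbackExtend A B K N x0 u k = u k :=
  if_pos hk

lemma traj_feedbackExtend_of_le {k : ℕ} (hk : k ≤ N) :
    traj A B x0 (feedbackExtend A B K N x0 u) k = traj A B x0 u k :=
  traj_congr (fun _ h => feedbackExtend_of_lt h) hk

lemma traj_feedbackExtend_add (j : ℕ) :
    traj A B x0 (feedbackExtend A B K N x0 u) (N + j) = (A + B * K) ^ j *ᵥ traj A B x0 u N := by
  induction j with
  | zero => simpa using traj_feedbackExtend_of_le le_rfl
  | succ j ih =>
    rw [← add_assoc, traj, ih, feedbackExtend, if_neg (by omega), pow_succ', ← mulVec_mulVec,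
      add_mulVec, ← mulVec_mulVec, Nat.add_sub_cancel_left]

lemma feedbackExtend_of_ge {k : ℕ} (hk : N ≤ k) :
    feedbackExtend A B K N x0 u k = K *ᵥ traj A B x0 (feedbackExtend A B K N x0 u) k := by
  obtain ⟨j, rfl⟩ := Nat.exists_eq_add_of_le hk
  rw [traj_feedbackExtend_add, feedbackExtend, if_neg (by omega), Nat.add_sub_cancel_left]

lemma feedbackResidual_segment (t : ℝ) (k : ℕ) :
    feedbackResidual A B K x0 (u + t • (v - u)) k = feedbackResidual A B K x0 u k +
      t • (feedbackResidual A B K x0 v k - feedbackResidual A B K x0 u k) := by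
  simp only [feedbackResidual, traj_segment, Pi.add_apply, Pi.smul_apply, Pi.sub_apply,
    mulVec_add, mulVec_smul, mulVec_sub]
  module

lemma eq_of_feedbackResidual_eq
    (h : ∀ k < N, feedbackResidual A B K x0 u k = feedbackResidual A B K x0 v k) :
    ∀ k < N, u k = v k := by
  have key : ∀ k ≤ N, traj A B x0 u k = traj A B x0 v k := by
    intro k
    induction k with
    | zero => intro _; rfl
    | succ k ih =>
      intro hk
      have hx := ih (by omega)
      have hu := h k (by omega)
      simp only [feedbackResidual, hx, sub_left_inj] at hu
      simp only [traj, hx, hu]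
  intro k hk
  have hu := h k hk
  simpa only [feedbackResidual, key k hk.le, sub_left_inj] using hu

end Feedback

/-- Completion of squares in the Bellman equation of the LQR problem, `S` being the Hessian. -/
def CompletesSquare {n m : ℕ} (A : Matrix (Fin n) (Fin n) ℝ) (B : Matrix (Fin n) (Fin m) ℝ)
    (Q : Matrix (Fin n) (Fin n) ℝ) (R : Matrix (Fin m) (Fin m) ℝ) (P : Matrix (Fin n) (Fin n) ℝ)
    (K : Matrix (Fin m) (Fin n) ℝ) (S : Matrix (Fin m) (Fin m) ℝ) : Prop :=
  ∀ (x : Fin n → ℝ) (w : Fin m → ℝ),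
    x ⬝ᵥ (Q *ᵥ x) + w ⬝ᵥ (R *ᵥ w) + (A *ᵥ x + B *ᵥ w) ⬝ᵥ (P *ᵥ (A *ᵥ x + B *ᵥ w)) =
      x ⬝ᵥ (P *ᵥ x) + (w - K *ᵥ x) ⬝ᵥ (S *ᵥ (w - K *ᵥ x))

lemma completesSquare_of_riccati {n m : ℕ} {A : Matrix (Fin n) (Fin n) ℝ}
    {B : Matrix (Fin n) (Fin m) ℝ} {Q : Matrix (Fin n) (Fin n) ℝ} {R : Matrix (Fin m) (Fin m) ℝ}
    {P : Matrix (Fin n) (Fin n) ℝ} {K : Matrix (Fin m) (Fin n) ℝ}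
    (hR : Rᵀ = R) (hP : Pᵀ = P) (hdet : IsUnit (R + Bᵀ * P * B).det)
    (hRic : P = Aᵀ * (P - P * B * (R + Bᵀ * P * B)⁻¹ * (Bᵀ * P)) * A + Q)
    (hK : K = -((Bᵀ * P * B + R)⁻¹ * (Bᵀ * P * A))) :
    CompletesSquare A B Q R P K (R + Bᵀ * P * B) := by
  rw [add_comm (Bᵀ * P * B) R] at hK
  set S := R + Bᵀ * P * B with hS
  have hST : Sᵀ = S := by
    simp only [hS, transpose_add, transpose_mul, transpose_transpose, hR, hP, Matrix.mul_assoc]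
  have hSK : S * K = -(Bᵀ * P * A) := by
    rw [hK, Matrix.mul_neg, Matrix.mul_nonsing_inv_cancel_left _ _ hdet]
  have hKS : Kᵀ * S = -(Aᵀ * P * B) := by
    have h := congrArg transpose hSK
    simpa only [transpose_mul, transpose_neg, transpose_transpose, hST, hP,
      ← Matrix.mul_assoc] using h
  have hPQ : P = Aᵀ * P * A + Aᵀ * P * B * K + Q := by
    conv_lhs => rw [hRic]
    rw [hK]
    simp only [Matrix.mul_add, Matrix.add_mul, Matrix.mul_neg, Matrix.neg_mul, Matrix.mul_assoc,
      sub_eq_add_neg]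
  have hKBPA : Kᵀ * Bᵀ * P * A = Aᵀ * P * B * K := by
    have h : Kᵀ * (S * K) = Kᵀ * S * K := (Matrix.mul_assoc _ _ _).symm
    rw [hSK, hKS, Matrix.mul_neg, Matrix.neg_mul, neg_inj] at h
    simpa only [← Matrix.mul_assoc] using h
  intro x w
  have move : ∀ {a b : ℕ} (M : Matrix (Fin a) (Fin b) ℝ) (y : Fin b → ℝ) (z : Fin a → ℝ),
      (M *ᵥ y) ⬝ᵥ z = y ⬝ᵥ (Mᵀ *ᵥ z) := by
    intro a b M y z
    rw [dotProduct_mulVec, vecMul_transpose]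
  have e1 : x ⬝ᵥ (P *ᵥ x) = x ⬝ᵥ ((Aᵀ * P * A + Aᵀ * P * B * K + Q) *ᵥ x) := by rw [← hPQ]
  rw [e1]
  simp only [mulVec_add, mulVec_sub, dotProduct_add, add_dotProduct, dotProduct_sub,
    sub_dotProduct, move, mulVec_mulVec, ← Matrix.mul_assoc, hSK, hKS, hKBPA, add_mulVec,
    neg_mulVec, dotProduct_neg]
  rw [hS]
  simp only [add_mulVec, dotProduct_add]
  ring

section Cost

variable {n m : ℕ} {A : Matrix (Fin n) (Fin n) ℝ} {B : Matrix (Fin n) (Fin m) ℝ}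
  {Q : Matrix (Fin n) (Fin n) ℝ} {R : Matrix (Fin m) (Fin m) ℝ} {P : Matrix (Fin n) (Fin n) ℝ}
  {K : Matrix (Fin m) (Fin n) ℝ} {S : Matrix (Fin m) (Fin m) ℝ}
  {x0 : Fin n → ℝ} {u v : ℕ → Fin m → ℝ} {N : ℕ}

lemma cost_zero : cost A B Q R P 0 x0 u = (1 / 2) * (x0 ⬝ᵥ (P *ᵥ x0)) := by
  simp [cost, traj]

lemma cost_succ (h : CompletesSquare A B Q R P K S) :
    cost A B Q R P (N + 1) x0 u = cost A B Q R P N x0 u +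
      (1 / 2) * (feedbackResidual A B K x0 u N ⬝ᵥ (S *ᵥ feedbackResidual A B K x0 u N)) := by
  have hN := h (traj A B x0 u N) (u N)
  simp only [cost, Finset.sum_range_succ, traj, feedbackResidual]
  linear_combination (1 / 2) * hN

lemma cost_congr (h : ∀ k < N, u k = v k) :
    cost A B Q R P N x0 u = cost A B Q R P N x0 v := by
  have hsum : ∀ k ∈ Finset.range N,
      traj A B x0 u k ⬝ᵥ (Q *ᵥ traj A B x0 u k) + u k ⬝ᵥ (R *ᵥ u k) =
        traj A B x0 v k ⬝ᵥ (Q *ᵥ traj A B x0 v k) + v k ⬝ᵥ (R *ᵥ v k) := by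
    intro k hk
    rw [traj_congr h (Finset.mem_range.1 hk).le, h k (Finset.mem_range.1 hk)]
  rw [cost, cost, traj_congr h le_rfl, Finset.sum_congr rfl hsum]

lemma cost_add_of_feedback (h : CompletesSquare A B Q R P K S) {l : ℕ}
    (hu : ∀ k, N ≤ k → k < N + l → u k = K *ᵥ traj A B x0 u k) :
    cost A B Q R P (N + l) x0 u = cost A B Q R P N x0 u := by
  induction l with
  | zero => rfl
  | succ l ih =>
    rw [← add_assoc, cost_succ h, ih fun k h1 h2 => hu k h1 (by omega)]
    simp [feedbackResidual, ← hu (N + l) (by omega) (by omega)]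

lemma cost_feedbackExtend (h : CompletesSquare A B Q R P K S) (l : ℕ) :
    cost A B Q R P (N + l) x0 (feedbackExtend A B K N x0 u) = cost A B Q R P N x0 u :=
  (cost_add_of_feedback h fun _ hk _ => feedbackExtend_of_ge hk).trans
    (cost_congr fun _ hk => feedbackExtend_of_lt hk)

lemma quadForm_nonneg (hS : S.PosDef) (a : Fin m → ℝ) : 0 ≤ a ⬝ᵥ (S *ᵥ a) := by
  simpa using hS.posSemidef.dotProduct_mulVec_nonneg a

lemma eq_zero_of_quadForm_nonpos (hS : S.PosDef) {a : Fin m → ℝ} (h : a ⬝ᵥ (S *ᵥ a) ≤ 0) :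
    a = 0 := by
  by_contra ha
  have := hS.dotProduct_mulVec_pos ha
  rw [star_trivial] at this
  linarith

lemma cost_le_cost_add (h : CompletesSquare A B Q R P K S) (hS : S.PosDef) (l : ℕ) :
    cost A B Q R P N x0 u ≤ cost A B Q R P (N + l) x0 u := by
  induction l with
  | zero => rfl
  | succ l ih =>
    rw [← add_assoc, cost_succ h]
    linarith [quadForm_nonneg hS (feedbackResidual A B K x0 u (N + l))]

lemma feedback_of_cost_add_le (h : CompletesSquare A B Q R P K S) (hS : S.PosDef) {l : ℕ}
    (hle : cost A B Q R P (N + l) x0 u ≤ cost A B Q R P N x0 u) :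
    ∀ k, N ≤ k → k < N + l → u k = K *ᵥ traj A B x0 u k := by
  intro k hk hkl
  obtain ⟨i, rfl⟩ := Nat.exists_eq_add_of_le hk
  obtain ⟨j, hj⟩ := Nat.exists_eq_add_of_le (Nat.succ_le_of_lt hkl)
  have h1 := cost_le_cost_add (x0 := x0) (u := u) (N := N) h hS i
  have h2 := cost_le_cost_add (x0 := x0) (u := u) (N := N + i + 1) h hS j
  rw [hj] at hle
  rw [cost_succ h] at h2
  exact sub_eq_zero.1 (eq_zero_of_quadForm_nonpos hS (a := feedbackResidual A B K x0 u (N + i))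
    (by rw [Nat.succ_eq_add_one] at hle; linarith))

lemma cost_segment (h : CompletesSquare A B Q R P K S) (t : ℝ) :
    cost A B Q R P N x0 (u + t • (v - u)) =
      (1 - t) * cost A B Q R P N x0 u + t * cost A B Q R P N x0 v -
        (1 / 2) * (t * (1 - t)) * ∑ k ∈ Finset.range N,
          ((feedbackResidual A B K x0 v k - feedbackResidual A B K x0 u k) ⬝ᵥ
            (S *ᵥ (feedbackResidual A B K x0 v k - feedbackResidual A B K x0 u k))) := by
  induction N with
  | zero => simp only [cost_zero, Finset.range_zero, Finset.sum_empty]; ring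
  | succ N ih =>
    rw [cost_succ h, cost_succ h, cost_succ h, ih, Finset.sum_range_succ,
      feedbackResidual_segment, quadForm_segment]
    ring

lemma cost_segment_le (h : CompletesSquare A B Q R P K S) (hS : S.PosDef) {t : ℝ} (ht0 : 0 ≤ t)
    (ht1 : t ≤ 1) :
    cost A B Q R P N x0 (u + t • (v - u)) ≤
      (1 - t) * cost A B Q R P N x0 u + t * cost A B Q R P N x0 v := by
  rw [cost_segment h, sub_le_self_iff]
  have := sub_nonneg.2 ht1
  have := Finset.sum_nonneg fun k (_ : k ∈ Finset.range N) =>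
    quadForm_nonneg hS (feedbackResidual A B K x0 v k - feedbackResidual A B K x0 u k)
  positivity

end Cost

section Optimality

variable {n m qX qU qT : ℕ} {A : Matrix (Fin n) (Fin n) ℝ} {B : Matrix (Fin n) (Fin m) ℝ}
  {Q : Matrix (Fin n) (Fin n) ℝ} {R : Matrix (Fin m) (Fin m) ℝ} {P : Matrix (Fin n) (Fin n) ℝ}
  {Cx : Matrix (Fin qX) (Fin n) ℝ} {cx : Fin qX → ℝ}
  {Cu : Matrix (Fin qU) (Fin m) ℝ} {cu : Fin qU → ℝ}
  {Ct : Matrix (Fin qT) (Fin n) ℝ} {ct : Fin qT → ℝ}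
  {K : Matrix (Fin m) (Fin n) ℝ} {S : Matrix (Fin m) (Fin m) ℝ}
  {x0 : Fin n → ℝ} {u v : ℕ → Fin m → ℝ} {N l : ℕ}

lemma Feasible.segment (hu : Feasible A B Cx cx Cu cu Ct ct N x0 u)
    (hv : Feasible A B Cx cx Cu cu Ct ct N x0 v) {t : ℝ} (ht0 : 0 ≤ t) (ht1 : t ≤ 1) :
    Feasible A B Cx cx Cu cu Ct ct N x0 (u + t • (v - u)) := by
  refine ⟨fun k hk => ⟨?_, ?_⟩, ?_⟩
  · rw [traj_segment]
    exact mulVec_segment_le ht0 ht1 (hu.1 k hk).1 (hv.1 k hk).1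
  · exact mulVec_segment_le ht0 ht1 (hu.1 k hk).2 (hv.1 k hk).2
  · rw [traj_segment]
    exact mulVec_segment_le ht0 ht1 hu.2 hv.2

/-- Convexity of the cost: an optimal sequence beats every sequence towards which one can move
a little without leaving the feasible set. -/
lemma IsOptimal.cost_le_of_eventually_feasible (h : CompletesSquare A B Q R P K S)
    (hS : S.PosDef) (hu : IsOptimal A B Q R P Cx cx Cu cu Ct ct N x0 u)
    (hv : ∀ᶠ t in nhdsWithin (0 : ℝ) (Ioi 0),
      Feasible A B Cx cx Cu cu Ct ct N x0 (u + t • (v - u))) :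
    cost A B Q R P N x0 u ≤ cost A B Q R P N x0 v := by
  obtain ⟨t, ht, ht0, ht1⟩ := (hv.and (Ioo_mem_nhdsGT (zero_lt_one' ℝ))).exists
  have h1 := hu.2 _ ht
  have h2 := cost_segment_le (N := N) (x0 := x0) (u := u) (v := v) h hS ht0.le ht1.le
  nlinarith

lemma IsOptimal.unique (h : CompletesSquare A B Q R P K S) (hS : S.PosDef)
    (hu : IsOptimal A B Q R P Cx cx Cu cu Ct ct N x0 u)
    (hv : IsOptimal A B Q R P Cx cx Cu cu Ct ct N x0 v) : ∀ k < N, u k = v k := by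
  have h1 := hu.2 _ (hu.1.segment hv.1 (t := 1 / 2) (by norm_num) (by norm_num))
  have h2 := hv.2 _ hu.1
  rw [cost_segment h] at h1
  have hsum := Finset.sum_eq_zero_iff_of_nonneg (s := Finset.range N) fun k _ =>
    quadForm_nonneg hS (feedbackResidual A B K x0 v k - feedbackResidual A B K x0 u k)
  have hnn := Finset.sum_nonneg fun k (_ : k ∈ Finset.range N) =>
    quadForm_nonneg hS (feedbackResidual A B K x0 v k - feedbackResidual A B K x0 u k)
  have hz := hsum.1 (le_antisymm (by linarith) hnn)
  exact eq_of_feedbackResidual_eq fun k hk =>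
    (sub_eq_zero.1 (eq_zero_of_quadForm_nonpos hS (hz k (Finset.mem_range.2 hk)).le)).symm

lemma Feasible.feedbackExtend
    (hT : ∀ x, Ct *ᵥ x ≤ ct ↔ ∀ k : ℕ, Cx *ᵥ ((A + B * K) ^ k *ᵥ x) ≤ cx ∧
      Cu *ᵥ (K *ᵥ ((A + B * K) ^ k *ᵥ x)) ≤ cu)
    (hu : Feasible A B Cx cx Cu cu Ct ct N x0 u) (l : ℕ) :
    Feasible A B Cx cx Cu cu Ct ct (N + l) x0 (feedbackExtend A B K N x0 u) := by
  refine ⟨fun k hk => ?_, ?_⟩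
  · rcases lt_or_ge k N with hkN | hkN
    · rw [traj_feedbackExtend_of_le hkN.le, feedbackExtend_of_lt hkN]
      exact hu.1 k hkN
    · rw [feedbackExtend_of_ge hkN]
      obtain ⟨j, rfl⟩ := Nat.exists_eq_add_of_le hkN
      rw [traj_feedbackExtend_add]
      exact (hT _).1 hu.2 j
  · rw [traj_feedbackExtend_add, hT]
    intro k
    have hpow : (A + B * K) ^ k *ᵥ ((A + B * K) ^ l *ᵥ traj A B x0 u N) =
        (A + B * K) ^ (k + l) *ᵥ traj A B x0 u N := by rw [mulVec_mulVec, pow_add]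
    rw [hpow]
    exact (hT _).1 hu.2 (k + l)

lemma strict_of_terminal_strict (hcx : ∀ i, 0 < cx i) (hcu : ∀ i, 0 < cu i)
    (hct : ∀ i, 0 < ct i)
    (hT : ∀ x, Ct *ᵥ x ≤ ct ↔ ∀ k : ℕ, Cx *ᵥ ((A + B * K) ^ k *ᵥ x) ≤ cx ∧
      Cu *ᵥ (K *ᵥ ((A + B * K) ^ k *ᵥ x)) ≤ cu)
    {x : Fin n → ℝ} (hx : ∀ r, (Ct *ᵥ x) r < ct r) (j : ℕ) :
    (∀ i, (Cx *ᵥ ((A + B * K) ^ j *ᵥ x)) i < cx i) ∧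
      (∀ i, (Cu *ᵥ (K *ᵥ ((A + B * K) ^ j *ᵥ x))) i < cu i) ∧
      (∀ r, (Ct *ᵥ ((A + B * K) ^ j *ᵥ x)) r < ct r) := by
  obtain ⟨t, ht, ht0⟩ :=
    ((eventually_mulVec_add_smul_le x hx).and self_mem_nhdsWithin).exists
  have hk := (hT _).1 ht
  refine ⟨mulVec_lt_of_mulVec_add_smul_self_le hcx ht0 ?_,
    mulVec_lt_of_mulVec_add_smul_self_le hcu ht0 ?_,
    mulVec_lt_of_mulVec_add_smul_self_le hct ht0 ?_⟩
  · simpa only [mulVec_add, mulVec_smul] using (hk j).1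
  · simpa only [mulVec_add, mulVec_smul] using (hk j).2
  · rw [hT]
    intro k
    simpa only [mulVec_add, mulVec_smul, mulVec_mulVec, pow_add, Matrix.mul_assoc] using hk (k + j)

lemma terminal_strict_of_strict (hct : ∀ i, 0 < ct i)
    (hT : ∀ x, Ct *ᵥ x ≤ ct ↔ ∀ k : ℕ, Cx *ᵥ ((A + B * K) ^ k *ᵥ x) ≤ cx ∧
      Cu *ᵥ (K *ᵥ ((A + B * K) ^ k *ᵥ x)) ≤ cu)
    {x : Fin n → ℝ}
    (hx : ∀ j < l, (∀ i, (Cx *ᵥ ((A + B * K) ^ j *ᵥ x)) i < cx i) ∧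
      (∀ i, (Cu *ᵥ (K *ᵥ ((A + B * K) ^ j *ᵥ x))) i < cu i))
    (hl : ∀ r, (Ct *ᵥ ((A + B * K) ^ l *ᵥ x)) r < ct r) :
    ∀ r, (Ct *ᵥ x) r < ct r := by
  have hev : ∀ᶠ t in nhdsWithin (0 : ℝ) (Ioi 0), ∀ j ∈ Finset.range l,
      Cx *ᵥ ((A + B * K) ^ j *ᵥ x + t • ((A + B * K) ^ j *ᵥ x)) ≤ cx ∧
      Cu *ᵥ (K *ᵥ ((A + B * K) ^ j *ᵥ x) + t • (K *ᵥ ((A + B * K) ^ j *ᵥ x))) ≤ cu :=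
    (Filter.eventually_all_finset _).2 fun j hj =>
      (eventually_mulVec_add_smul_le _ (hx j (Finset.mem_range.1 hj)).1).and
        (eventually_mulVec_add_smul_le _ (hx j (Finset.mem_range.1 hj)).2)
  obtain ⟨t, ⟨ht, htl⟩, ht0⟩ :=
    ((hev.and (eventually_mulVec_add_smul_le _ hl)).and self_mem_nhdsWithin).exists
  refine mulVec_lt_of_mulVec_add_smul_self_le hct ht0 ((hT _).2 fun k => ?_)
  rcases lt_or_ge k l with hk | hk
  · simpa only [mulVec_add, mulVec_smul] using ht k (Finset.mem_range.2 hk)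
  · obtain ⟨j, rfl⟩ := Nat.exists_eq_add_of_le' hk
    have hpow : (A + B * K) ^ (j + l) *ᵥ (x + t • x) =
        (A + B * K) ^ j *ᵥ ((A + B * K) ^ l *ᵥ x + t • ((A + B * K) ^ l *ᵥ x)) := by
      rw [pow_add, ← mulVec_mulVec, mulVec_add, mulVec_smul]
    rw [hpow]
    exact (hT _).1 htl j

lemma IsOptimal.feedbackExtend (h : CompletesSquare A B Q R P K S) (hS : S.PosDef)
    (hT : ∀ x, Ct *ᵥ x ≤ ct ↔ ∀ k : ℕ, Cx *ᵥ ((A + B * K) ^ k *ᵥ x) ≤ cx ∧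
      Cu *ᵥ (K *ᵥ ((A + B * K) ^ k *ᵥ x)) ≤ cu)
    (hu : IsOptimal A B Q R P Cx cx Cu cu Ct ct N x0 u)
    (huT : ∀ r, (Ct *ᵥ traj A B x0 u N) r < ct r) (l : ℕ) :
    IsOptimal A B Q R P Cx cx Cu cu Ct ct (N + l) x0 (feedbackExtend A B K N x0 u) := by
  refine ⟨hu.1.feedbackExtend hT l, fun v hv => ?_⟩
  rw [cost_feedbackExtend h]
  refine le_trans (hu.cost_le_of_eventually_feasible h hS ?_) (cost_le_cost_add h hS l)
  filter_upwards [eventually_mulVec_add_smul_le (traj A B x0 v N - traj A B x0 u N) huT,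
    Ioo_mem_nhdsGT (zero_lt_one' ℝ)] with t ht ht01
  refine ⟨fun k hk => ⟨?_, ?_⟩, ?_⟩
  · rw [traj_segment]
    exact mulVec_segment_le ht01.1.le ht01.2.le (hu.1.1 k hk).1 (hv.1 k (by omega)).1
  · exact mulVec_segment_le ht01.1.le ht01.2.le (hu.1.1 k hk).2 (hv.1 k (by omega)).2
  · rwa [traj_segment]

/-- Where no constraint is active from stage `N` on, the optimal control is the feedback `K`. -/
lemma IsOptimal.feedback_of_strict (h : CompletesSquare A B Q R P K S) (hS : S.PosDef)
    (hu : IsOptimal A B Q R P Cx cx Cu cu Ct ct (N + l) x0 u)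
    (hin : ∀ k, N ≤ k → k < N + l →
      (∀ i, (Cx *ᵥ traj A B x0 u k) i < cx i) ∧ (∀ j, (Cu *ᵥ u k) j < cu j))
    (huT : ∀ r, (Ct *ᵥ traj A B x0 u (N + l)) r < ct r) :
    ∀ k, N ≤ k → k < N + l → u k = K *ᵥ traj A B x0 u k := by
  refine feedback_of_cost_add_le h hS ?_
  rw [← cost_feedbackExtend (N := N) h l]
  refine hu.cost_le_of_eventually_feasible h hS ?_
  set v := _root_.feedbackExtend A B K N x0 u
  have hev : ∀ᶠ t in nhdsWithin (0 : ℝ) (Ioi 0), ∀ k ∈ Finset.Ico N (N + l),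
      Cx *ᵥ (traj A B x0 u k + t • (traj A B x0 v k - traj A B x0 u k)) ≤ cx ∧
        Cu *ᵥ (u k + t • (v k - u k)) ≤ cu :=
    (Filter.eventually_all_finset _).2 fun k hk =>
      have hk := Finset.mem_Ico.1 hk
      (eventually_mulVec_add_smul_le _ (hin k hk.1 hk.2).1).and
        (eventually_mulVec_add_smul_le _ (hin k hk.1 hk.2).2)
  filter_upwards [hev, eventually_mulVec_add_smul_le
    (traj A B x0 v (N + l) - traj A B x0 u (N + l)) huT] with t ht htT
  refine ⟨fun k hk => ?_, by rwa [traj_segment]⟩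
  rw [traj_segment]
  rcases lt_or_ge k N with hkN | hkN
  · have hv : v k = u k := feedbackExtend_of_lt hkN
    have hx : traj A B x0 v k = traj A B x0 u k := traj_feedbackExtend_of_le hkN.le
    simpa [hv, hx] using hu.1.1 k hk
  · exact ht k (Finset.mem_Ico.2 ⟨hkN, hk⟩)

lemma IsOptimal.truncate (h : CompletesSquare A B Q R P K S)
    (hT : ∀ x, Ct *ᵥ x ≤ ct ↔ ∀ k : ℕ, Cx *ᵥ ((A + B * K) ^ k *ᵥ x) ≤ cx ∧
      Cu *ᵥ (K *ᵥ ((A + B * K) ^ k *ᵥ x)) ≤ cu)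
    (hu : IsOptimal A B Q R P Cx cx Cu cu Ct ct (N + l) x0 u)
    (hK : ∀ k, N ≤ k → k < N + l → u k = K *ᵥ traj A B x0 u k)
    (huT : Ct *ᵥ traj A B x0 u N ≤ ct) :
    IsOptimal A B Q R P Cx cx Cu cu Ct ct N x0 u := by
  refine ⟨⟨fun k hk => hu.1.1 k (by omega), huT⟩, fun v hv => ?_⟩
  rw [← cost_add_of_feedback h hK, ← cost_feedbackExtend (u := v) h l]
  exact hu.2 _ (hv.feedbackExtend hT l)

end Optimality

/-- the polytope defined by an active pattern with empty terminal part is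
persistent: `P_N(α) = P_{N+l}(α 0^l)` for every `l ≥ 0`, and the optimal solutions coincide
on it (with LQR feedback on the appended stages). -/
theorem stmt4
    {n m qX qU qT : ℕ}
    (A : Matrix (Fin n) (Fin n) ℝ) (B : Matrix (Fin n) (Fin m) ℝ)
    (Q : Matrix (Fin n) (Fin n) ℝ) (R : Matrix (Fin m) (Fin m) ℝ)
    (P : Matrix (Fin n) (Fin n) ℝ)
    (Cx : Matrix (Fin qX) (Fin n) ℝ) (cx : Fin qX → ℝ)
    (Cu : Matrix (Fin qU) (Fin m) ℝ) (cu : Fin qU → ℝ)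
    (Ct : Matrix (Fin qT) (Fin n) ℝ) (ct : Fin qT → ℝ)
    (hQ : Q.PosSemidef) (hR : R.PosDef) (hP : P.PosSemidef)
    (Kinf : Matrix (Fin m) (Fin n) ℝ)
    (hdet : IsUnit (R + Bᵀ * P * B).det)
    (hRic : P = Aᵀ * (P - P * B * (R + Bᵀ * P * B)⁻¹ * (Bᵀ * P)) * A + Q)
    (hK : Kinf = -((Bᵀ * P * B + R)⁻¹ * (Bᵀ * P * A)))
    (Xs : Set (Fin n → ℝ)) (hXs : Xs = {x | Cx *ᵥ x ≤ cx})
    (Us : Set (Fin m → ℝ)) (hUs : Us = {v | Cu *ᵥ v ≤ cu})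
    (Ts : Set (Fin n → ℝ)) (hTs : Ts = {x | Ct *ᵥ x ≤ ct})
    (XU : Set (Fin n → ℝ)) (hXU : XU = {x ∈ Xs | Kinf *ᵥ x ∈ Us})
    (hTchar : Ts = {x ∈ Xs | ∀ k : ℕ, ((A + B * Kinf) ^ k) *ᵥ x ∈ XU})
    (hXc : IsCompact Xs) (hUc : IsCompact Us) (hTc : IsCompact Ts)
    (hX0 : (0 : Fin n → ℝ) ∈ interior Xs)
    (hU0 : (0 : Fin m → ℝ) ∈ interior Us)
    (hT0 : (0 : Fin n → ℝ) ∈ interior Ts)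
    (hXint : interior Xs = {x | ∀ i, (Cx *ᵥ x) i < cx i})
    (hUint : interior Us = {v | ∀ j, (Cu *ᵥ v) j < cu j})
    (hTint : interior Ts = {x | ∀ r, (Ct *ᵥ x) r < ct r})
    (N : ℕ) (hN : 1 ≤ N) (α : ℕ → Set (Fin qX) × Set (Fin qU)) (l : ℕ) :
    PolyPad A B Q R P Cx cx Cu cu Ct ct N 0 α = PolyPad A B Q R P Cx cx Cu cu Ct ct N l α ∧
    ∀ x0 ∈ PolyPad A B Q R P Cx cx Cu cu Ct ct N 0 α, ∀ uN uNl,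
      IsOptimal A B Q R P Cx cx Cu cu Ct ct N x0 uN → IsOptimal A B Q R P Cx cx Cu cu Ct ct (N + l) x0 uNl →
        (∀ k < N, uNl k = uN k) ∧
        (∀ k, N ≤ k → k < N + l → uNl k = Kinf *ᵥ traj A B x0 uNl k) := by
  have hS : (R + Bᵀ * P * B).PosDef := by
    have := hP.conjTranspose_mul_mul_same B
    rw [conjTranspose_eq_transpose_of_trivial] at this
    exact hR.add_posSemidef this
  have hRT : Rᵀ = R := by
    simpa only [conjTranspose_eq_transpose_of_trivial] using hR.isHermitian.eq
  have hPT : Pᵀ = P := by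
    simpa only [conjTranspose_eq_transpose_of_trivial] using hP.isHermitian.eq
  have hsq : CompletesSquare A B Q R P Kinf (R + Bᵀ * P * B) :=
    completesSquare_of_riccati hRT hPT hdet hRic hK
  have hcx : ∀ i, 0 < cx i := by rw [hXint] at hX0; simpa using hX0
  have hcu : ∀ i, 0 < cu i := by rw [hUint] at hU0; simpa using hU0
  have hct : ∀ i, 0 < ct i := by rw [hTint] at hT0; simpa using hT0
  have hT : ∀ x, Ct *ᵥ x ≤ ct ↔ ∀ k : ℕ, Cx *ᵥ ((A + B * Kinf) ^ k *ᵥ x) ≤ cx ∧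
      Cu *ᵥ (Kinf *ᵥ ((A + B * Kinf) ^ k *ᵥ x)) ≤ cu := by
    intro x
    have hx := Set.ext_iff.1 hTchar x
    rw [hXU, hTs, hXs, hUs] at hx
    simp only [Set.mem_ofPred_eq] at hx
    exact hx.trans ⟨fun h => h.2, fun h => ⟨by simpa using (h 0).1, h⟩⟩
  refine ⟨Set.Subset.antisymm ?_ ?_, ?_⟩
  · rintro x0 ⟨u, hu, hα, -, huT⟩
    rw [add_zero] at hu huT
    refine ⟨feedbackExtend A B Kinf N x0 u, hu.feedbackExtend hsq hS hT huT l, ?_, ?_, ?_⟩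
    · intro k hk
      rw [feedbackExtend_of_lt hk, traj_feedbackExtend_of_le hk.le]
      exact hα k hk
    · intro k hk _
      rw [feedbackExtend_of_ge hk]
      obtain ⟨j, rfl⟩ := Nat.exists_eq_add_of_le hk
      rw [traj_feedbackExtend_add]
      have hj := strict_of_terminal_strict hcx hcu hct hT huT j
      exact ⟨hj.1, hj.2.1⟩
    · rw [traj_feedbackExtend_add]
      exact (strict_of_terminal_strict hcx hcu hct hT huT l).2.2
  · rintro x0 ⟨u, hu, hα, hin, huT⟩
    have hfb := hu.feedback_of_strict hsq hS hin huT
    have hNT : ∀ r, (Ct *ᵥ traj A B x0 u N) r < ct r := by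
      refine terminal_strict_of_strict (l := l) hct hT (fun j hj => ?_) ?_
      · rw [← traj_add_of_feedback hfb hj.le, ← hfb (N + j) (by omega) (by omega)]
        exact hin (N + j) (by omega) (by omega)
      · rwa [← traj_add_of_feedback hfb le_rfl]
    exact ⟨u, hu.truncate hsq hT hfb fun r => (hNT r).le, hα, fun k h1 h2 => by omega, hNT⟩
  · rintro x0 ⟨u, hu, -, -, huT⟩ uN uNl huN huNl
    rw [add_zero] at hu huT
    have h1 := huN.unique hsq hS hu
    have h2 := huNl.unique hsq hS (hu.feedbackExtend hsq hS hT huT l)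
    refine ⟨fun k hk => ?_, fun k hk hkl => ?_⟩
    · rw [h2 k (by omega), feedbackExtend_of_lt hk, h1 k hk]
    · rw [h2 k hkl, traj_congr h2 hkl.le]
      exact feedbackExtend_of_ge hk
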